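/- arXiv:2302.00323 — 3 statements merged into one kernel-verified Lean document; each statement's English description precedes it below -/
import Mathlib

section
/- Fix integers n ≥ 2 and m ≥ 1 and a real number α with 0 < α < 1 and m ≥ ⌈1/α⌉. There exists v ∈ V(α;m) with MMS_n(v) = Δ, where Δ is given by: Δ = α if α > 1/n; Δ = 1/n if α = 1/(kn) for some integer k ≥ 1, or if 1/((k+1)n) < α < 1/(kn) for some integer k ≥ 1 and m ≥ kn + n; and Δ = kα + (1 − knα)/(m − kn) if 1/((k+1)n) < α < 1/(kn) for some integer k ≥ 1 and m ≤ kn + n − 1. -/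
open Finset

/-- A (normalised, additive) disutility function on `m` objects. -/
def IsDisutility (m : ℕ) (v : Fin m → ℝ) : Prop :=
  (∀ e, 0 ≤ v e) ∧ ∑ e, v e = 1

/-- The MinMaxShare of `v` among `n` agents: the minimum over allocations
`A : Fin m → Fin n` of the maximum bundle disutility. -/
noncomputable def MMS (n m : ℕ) (v : Fin m → ℝ) : ℝ :=
  ⨅ A : Fin m → Fin n, ⨆ j : Fin n, ∑ e ∈ Finset.univ.filter (fun e => A e = j), v e

/-- `v ∈ V(α;m)`: a disutility function on `m` objects whose maximum single-object
value equals `α`. -/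
def Vmem (α : ℝ) (m : ℕ) (v : Fin m → ℝ) : Prop :=
  IsDisutility m v ∧ (⨆ e, v e) = α

/-- The profile with `K` objects of value `α`, then `r` objects of value `β`, then zeros. -/
noncomputable def twoLevel (m K r : ℕ) (α β : ℝ) (e : Fin m) : ℝ :=
  if e.val < K then α else if e.val < K + r then β else 0

theorem sum_twoLevel {m K r : ℕ} (h : K + r ≤ m) (α β : ℝ) :
    ∑ e, twoLevel m K r α β e = K * α + r * β := by
  obtain ⟨t, rfl⟩ := Nat.exists_eq_add_of_le h
  unfold twoLevel
  rw [Fin.sum_univ_eq_sum_range (fun e => if e < K then α else if e < K + r then β else 0),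
    Finset.sum_range_add, Finset.sum_range_add]
  have h1 : ∑ x ∈ range K, (if x < K then α else if x < K + r then β else 0) = K * α := by
    rw [Finset.sum_congr rfl (g := fun _ => α) (fun x hx => if_pos (mem_range.mp hx))]
    simp
  have h2 : ∑ x ∈ range r, (if K + x < K then α else if K + x < K + r then β else 0)
      = r * β := by
    rw [Finset.sum_congr rfl (g := fun _ => β) (fun x hx => by simp [mem_range.mp hx])]
    simp
  have h3 : ∑ x ∈ range t,
      (if K + r + x < K then α else if K + r + x < K + r then β else 0) = 0 := by
    refine Finset.sum_eq_zero fun x _ => ?_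
    rw [if_neg (by lia), if_neg (by lia)]
  rw [h1, h2, h3, add_zero]

theorem twoLevel_le {m K r : ℕ} {α β : ℝ} (hα : 0 ≤ α) (hβα : β ≤ α) (e : Fin m) :
    twoLevel m K r α β e ≤ α := by
  unfold twoLevel
  split_ifs <;> linarith

theorem vmem_twoLevel {m K r : ℕ} {α β : ℝ} (hK : 1 ≤ K) (h : K + r ≤ m) (hβ : 0 ≤ β)
    (hβα : β ≤ α) (hsum : K * α + r * β = 1) : Vmem α m (twoLevel m K r α β) := by
  have hα : 0 ≤ α := hβ.trans hβα
  refine ⟨⟨fun e => ?_, by rw [sum_twoLevel h, hsum]⟩, ?_⟩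
  · unfold twoLevel
    split_ifs <;> first | assumption | exact le_rfl
  · have : Nonempty (Fin m) := ⟨⟨0, by lia⟩⟩
    refine le_antisymm (ciSup_le (twoLevel_le hα hβα)) ?_
    have h0 := le_ciSup (Set.finite_range (twoLevel m K r α β)).bddAbove ⟨0, by lia⟩
    rwa [show twoLevel m K r α β ⟨0, by lia⟩ = α from if_pos hK] at h0

theorem le_MMS {n m : ℕ} (hn : 0 < n) {v : Fin m → ℝ} {c : ℝ}
    (h : ∀ A : Fin m → Fin n, ∃ j, c ≤ ∑ e ∈ univ.filter (fun e => A e = j), v e) :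
    c ≤ MMS n m v := by
  have : Nonempty (Fin n) := ⟨⟨0, hn⟩⟩
  refine le_ciInf fun A => ?_
  obtain ⟨j, hj⟩ := h A
  exact hj.trans (le_ciSup (f := fun j => ∑ e ∈ univ.filter (fun e => A e = j), v e)
    (Set.finite_range _).bddAbove j)

theorem MMS_le {n m : ℕ} (hn : 0 < n) {v : Fin m → ℝ} {c : ℝ} (A : Fin m → Fin n)
    (h : ∀ j, ∑ e ∈ univ.filter (fun e => A e = j), v e ≤ c) : MMS n m v ≤ c := by
  have : Nonempty (Fin n) := ⟨⟨0, hn⟩⟩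
  exact (ciInf_le (Set.finite_range _).bddBelow A).trans (ciSup_le h)

/-- Round-robin allocation gives every agent at most `k` objects of value at most `α` and one of
value at most `β`. -/
theorem MMS_le_of_roundRobin {n m : ℕ} (hn : 0 < n) (k : ℕ) {v : Fin m → ℝ} {α β : ℝ}
    (hα : 0 ≤ α) (hβ : 0 ≤ β) (hvα : ∀ e, v e ≤ α) (hvβ : ∀ e, k * n ≤ e.val → v e ≤ β)
    (hv0 : ∀ e, k * n + n ≤ e.val → v e ≤ 0) : MMS n m v ≤ k * α + β := by
  refine MMS_le hn (fun e => ⟨e.val % n, Nat.mod_lt _ hn⟩) fun j => ?_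
  set F := univ.filter (fun e : Fin m => (⟨e.val % n, Nat.mod_lt _ hn⟩ : Fin n) = j) with hF
  let g : ℕ → ℝ := fun i => if i < k then α else if i = k then β else 0
  have hg : ∀ i, 0 ≤ g i := fun i => by
    simp only [g]
    split_ifs <;> first | assumption | exact le_rfl
  have hinj : Set.InjOn (fun e : Fin m => e.val / n) F := by
    intro a ha b hb hab
    simp only [hF, coe_filter, mem_univ, true_and, Set.mem_ofPred_eq, Fin.ext_iff] at ha hb
    have hab' : a.val / n = b.val / n := hab
    rw [Fin.ext_iff, ← Nat.div_add_mod a.val n, ← Nat.div_add_mod b.val n, hab', ha, hb]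
  calc ∑ e ∈ F, v e ≤ ∑ e ∈ F, g (e.val / n) := by
        refine Finset.sum_le_sum fun e _ => ?_
        simp only [g]
        split_ifs with h1 h2
        · exact hvα e
        · exact hvβ e ((Nat.le_div_iff_mul_le hn).mp h2.ge)
        · refine hv0 e ?_
          have := (Nat.le_div_iff_mul_le hn).mp (show k + 1 ≤ e.val / n by lia)
          linarith
    _ = ∑ i ∈ F.image (fun e : Fin m => e.val / n), g i := (Finset.sum_image hinj).symm
    _ ≤ ∑ i ∈ F.image (fun e : Fin m => e.val / n) ∪ range (k + 1), g i :=
        Finset.sum_le_sum_of_subset_of_nonneg subset_union_left fun i _ _ => hg i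
    _ = ∑ i ∈ range (k + 1), g i := by
        refine (Finset.sum_subset subset_union_right fun i _ hi => ?_).symm
        rw [mem_range] at hi
        simp only [g]
        rw [if_neg (by lia), if_neg (by lia)]
    _ = k * α + β := by
        rw [Finset.sum_range_succ, Finset.sum_congr rfl (g := fun _ => α)
          (fun x hx => if_pos (mem_range.mp hx))]
        simp [g]

theorem le_MMS_of_vmem {n m : ℕ} (hn : 0 < n) (hm : 1 ≤ m) {α : ℝ} {v : Fin m → ℝ}
    (hv : Vmem α m v) : α ≤ MMS n m v := by
  have : Nonempty (Fin m) := ⟨⟨0, hm⟩⟩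
  obtain ⟨e, he⟩ := exists_eq_ciSup_of_finite (f := v)
  refine le_MMS hn fun A => ⟨A e, ?_⟩
  rw [← hv.2, ← he]
  exact Finset.single_le_sum (f := v) (fun i _ => hv.1.1 i) (by simp)

theorem one_div_le_MMS {n m : ℕ} (hn : 0 < n) {v : Fin m → ℝ} (hv : ∑ e, v e = 1) :
    1 / (n : ℝ) ≤ MMS n m v := by
  refine le_MMS hn fun A => ?_
  by_contra! h
  have : Nonempty (Fin n) := ⟨⟨0, hn⟩⟩
  have h1 := Finset.sum_lt_sum_of_nonempty (s := (univ : Finset (Fin n))) univ_nonempty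
    (fun j _ => h j)
  rw [Finset.sum_fiberwise, hv] at h1
  have hn' : (n : ℝ) ≠ 0 := by positivity
  simp [hn'] at h1

/-- If the first `k * n` objects are worth at least `α` and the next one at least `β`, some agent
gets at least `k + 1` of these objects. -/
theorem le_MMS_of_pigeonhole {n m k : ℕ} (hn : 0 < n) (hkm : k * n < m) {v : Fin m → ℝ} {α β : ℝ}
    (hβ : 0 ≤ β) (hβα : β ≤ α) (hv : ∀ e, 0 ≤ v e) (hvα : ∀ e, e.val < k * n → α ≤ v e)
    (hvβ : β ≤ v ⟨k * n, hkm⟩) : k * α + β ≤ MMS n m v := by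
  refine le_MMS hn fun A => ?_
  let e₀ : Fin m := ⟨k * n, hkm⟩
  have hcard : (Finset.univ : Finset (Fin n)).card * k < (Finset.Iic e₀).card := by
    rw [Fin.card_Iic, card_univ, Fintype.card_fin, mul_comm]
    exact Nat.lt_succ_self _
  obtain ⟨j, -, hj⟩ := Finset.exists_lt_card_fiber_of_mul_lt_card_of_maps_to
    (f := A) (fun e _ => mem_univ (A e)) hcard
  refine ⟨j, ?_⟩
  set F := (Finset.Iic e₀).filter (fun e => A e = j)
  have hj' : (k : ℝ) + 1 ≤ F.card := by exact_mod_cast hj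
  calc k * α + β ≤ F.card * α - (α - β) := by
        nlinarith [mul_le_mul_of_nonneg_right hj' (hβ.trans hβα)]
    _ ≤ ∑ e ∈ F, (α - if e = e₀ then α - β else 0) := by
        rw [Finset.sum_sub_distrib, Finset.sum_const, nsmul_eq_mul, Finset.sum_ite_eq']
        split_ifs <;> linarith
    _ ≤ ∑ e ∈ F, v e := by
        refine Finset.sum_le_sum fun e he => ?_
        split_ifs with h
        · rw [h]
          simpa using hvβ
        · have h1 : e ≤ e₀ := Finset.mem_Iic.mp (Finset.mem_filter.mp he).1
          have h2 := hvα e (Fin.lt_def.mp (lt_of_le_of_ne h1 h))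
          linarith
    _ ≤ _ := Finset.sum_le_sum_of_subset_of_nonneg
        (Finset.filter_subset_filter _ (subset_univ _)) fun e _ _ => hv e

theorem exists_MMS_eq_max {n m : ℕ} (hn : 0 < n) (hm : 1 ≤ m) {α : ℝ} (hα0 : 0 < α) (hα1 : α < 1)
    (hmα : 1 / α ≤ m) (hα : 1 / (n : ℝ) < α) :
    ∃ v : Fin m → ℝ, Vmem α m v ∧ MMS n m v = α := by
  have hn' : (0 : ℝ) < n := by exact_mod_cast hn
  have hαn : 1 / α ≤ n := ((one_div_lt hn' hα0).mp hα).le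
  have h1 : 1 < ⌈1 / α⌉₊ := by
    rw [Nat.lt_ceil, Nat.cast_one]
    exact (one_lt_div hα0).mpr hα1
  obtain ⟨K, hK⟩ : ∃ K, ⌈1 / α⌉₊ = K + 1 := ⟨⌈1 / α⌉₊ - 1, by lia⟩
  have hKm : K + 1 ≤ m := hK ▸ Nat.ceil_le.mpr hmα
  have hKn : K + 1 ≤ n := hK ▸ Nat.ceil_le.mpr hαn
  have hle : 1 ≤ ((K : ℝ) + 1) * α := by
    have := Nat.le_ceil (1 / α)
    rw [hK, div_le_iff₀ hα0] at this
    exact_mod_cast this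
  have hlt : (K : ℝ) * α < 1 := by
    have : (K : ℝ) < 1 / α := Nat.lt_ceil.mp (by lia)
    rwa [lt_div_iff₀ hα0] at this
  have hv : Vmem α m (twoLevel m K 1 α (1 - K * α)) :=
    vmem_twoLevel (by lia) hKm (by linarith) (by linarith) (by push_cast; ring)
  refine ⟨_, hv, le_antisymm ?_ (le_MMS_of_vmem hn hm hv)⟩
  have hle' := twoLevel_le (m := m) (K := K) (r := 1) hα0.le (show 1 - K * α ≤ α by linarith)
  have := MMS_le_of_roundRobin hn 0 hα0.le hα0.le hle' (fun e _ => hle' e) fun e he => by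
    unfold twoLevel
    rw [if_neg (by lia), if_neg (by lia)]
  simpa using this

/-- A profile of `k * n` objects of value `α` and `r ≤ n` objects of value `β`. -/
theorem MMS_twoLevel_le {n m k r : ℕ} (hn : 0 < n) (hr : r ≤ n) {α β : ℝ} (hβ : 0 ≤ β)
    (hβα : β ≤ α) : MMS n m (twoLevel m (k * n) r α β) ≤ k * α + β := by
  have hα := hβ.trans hβα
  refine MMS_le_of_roundRobin hn k hα hβ (twoLevel_le hα hβα) (fun e he => ?_) fun e he => ?_
  · unfold twoLevel
    rw [if_neg (by lia)]
    split_ifs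
    exacts [le_rfl, hβ]
  · unfold twoLevel
    rw [if_neg (by lia), if_neg (by lia)]

theorem exists_MMS_eq_one_div {n m k r : ℕ} (hn : 0 < n) (hk : 1 ≤ k) (hr : r ≤ n)
    (hm : k * n + r ≤ m) {α β : ℝ} (hβ : 0 ≤ β) (hβα : β ≤ α)
    (hsum : ((k * n : ℕ) : ℝ) * α + r * β = 1) (hshare : k * α + β = 1 / n) :
    ∃ v : Fin m → ℝ, Vmem α m v ∧ MMS n m v = 1 / (n : ℝ) := by
  have hv := vmem_twoLevel (Nat.mul_pos hk hn) hm hβ hβα hsum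
  exact ⟨_, hv, le_antisymm (hshare ▸ MMS_twoLevel_le hn hr hβ hβα) (one_div_le_MMS hn hv.1.2)⟩

theorem stmt1 (n m : ℕ) (hn : 2 ≤ n) (hm : 1 ≤ m) (α : ℝ) (hα0 : 0 < α) (hα1 : α < 1)
    (hmα : ⌈1/α⌉ ≤ (m : ℤ)) :
    (1/(n:ℝ) < α → ∃ v : Fin m → ℝ, Vmem α m v ∧ MMS n m v = α) ∧
    (((∃ k : ℕ, 1 ≤ k ∧ α = 1/((k:ℝ)*(n:ℝ))) ∨
      (∃ k : ℕ, 1 ≤ k ∧ 1/(((k:ℝ)+1)*(n:ℝ)) < α ∧ α < 1/((k:ℝ)*(n:ℝ)) ∧ k*n + n ≤ m)) →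
      ∃ v : Fin m → ℝ, Vmem α m v ∧ MMS n m v = 1/(n:ℝ)) ∧
    (∀ k : ℕ, 1 ≤ k → 1/(((k:ℝ)+1)*(n:ℝ)) < α → α < 1/((k:ℝ)*(n:ℝ)) →
      (m : ℤ) ≤ (k:ℤ)*n + n - 1 →
      ∃ v : Fin m → ℝ, Vmem α m v ∧
        MMS n m v = (k:ℝ)*α + (1 - (k:ℝ)*(n:ℝ)*α)/((m:ℝ) - (k:ℝ)*(n:ℝ))) := by
  have hn0 : 0 < n := by lia
  have hn' : (0 : ℝ) < n := by exact_mod_cast hn0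
  have hmα' : 1 / α ≤ m := by exact_mod_cast Int.ceil_le.mp hmα
  have h1m : 1 ≤ m * α := (div_le_iff₀ hα0).mp hmα'
  refine ⟨exists_MMS_eq_max hn0 hm hα0 hα1 hmα', ?_, ?_⟩
  · rintro (⟨k, hk, rfl⟩ | ⟨k, hk, hlo, hhi, hkm⟩)
    · have hk' : (0 : ℝ) < k := by exact_mod_cast hk
      rw [one_div_one_div] at hmα'
      have hkm : k * n ≤ m := by exact_mod_cast hmα'
      refine exists_MMS_eq_one_div (r := 0) hn0 hk (Nat.zero_le n) hkm le_rfl hα0.le ?_ ?_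
      · push_cast
        field_simp
        simp
      · field_simp
        simp
    · have hk' : (0 : ℝ) < k := by exact_mod_cast hk
      rw [div_lt_iff₀ (by positivity)] at hlo
      rw [lt_div_iff₀ (by positivity)] at hhi
      refine exists_MMS_eq_one_div (r := n) (β := 1 / n - k * α) hn0 hk le_rfl hkm ?_ ?_ ?_ ?_
      · rw [sub_nonneg, le_div_iff₀ hn']
        linarith
      · rw [sub_le_iff_le_add, div_le_iff₀ hn']
        linarith
      · push_cast
        field_simp
        ring
      · ring
  · intro k hk hlo hhi hmk
    have hk' : (0 : ℝ) < k := by exact_mod_cast hk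
    rw [lt_div_iff₀ (by positivity)] at hhi
    have hkm : k * n < m := by
      have : (k : ℝ) * n < m := by
        by_contra! h
        nlinarith
      exact_mod_cast this
    obtain ⟨r, rfl⟩ := Nat.exists_eq_add_of_lt hkm
    have hrn : r + 1 ≤ n := by
      push_cast at hmk
      lia
    have hr : ((k * n + r + 1 : ℕ) : ℝ) - k * n = ((r + 1 : ℕ) : ℝ) := by
      push_cast
      ring
    have hr0 : (0 : ℝ) < ((r + 1 : ℕ) : ℝ) := by positivity
    rw [hr]
    set β : ℝ := (1 - k * n * α) / ((r + 1 : ℕ) : ℝ) with hβdef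
    have hβ : 0 ≤ β := div_nonneg (by linarith) hr0.le
    have hβα : β ≤ α := by
      rw [hβdef, div_le_iff₀ hr0]
      push_cast at h1m ⊢
      linarith
    have hv : Vmem α (k * n + r + 1) (twoLevel (k * n + r + 1) (k * n) (r + 1) α β) :=
      vmem_twoLevel (Nat.mul_pos hk hn0) le_rfl hβ hβα (by
        rw [hβdef, mul_div_cancel₀ _ hr0.ne']
        push_cast
        ring)
    refine ⟨_, hv, le_antisymm (MMS_twoLevel_le hn0 hrn hβ hβα)
      (le_MMS_of_pigeonhole hn0 hkm hβ hβα hv.1.1 (fun e he => ?_) ?_)⟩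
    · simp [twoLevel, he]
    · simp [twoLevel]
end

section
/- Let n ≥ 2 and k ≥ 0 be integers, not simultaneously n = 2 and k = 1, let α ∈ D(n,k), and let m be an integer with ⌈1/α⌉ ≤ m ≤ kn + n. Then every v ∈ V(α;m) satisfies MMS_n(v) ≤ (k+1)α, and there exists v ∈ V(α;m) with MMS_n(v) = (k+1)α (for instance, the disutility function assigning value α to ⌈1/α⌉ − 1 objects, value 1 − (⌈1/α⌉ − 1)α to one object, and value 0 to the remaining m − ⌈1/α⌉ objects). -/
open Finset

/-- Some allocation gives every agent at most `q` of `m ≤ n * q` objects. -/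
theorem exists_allocation_card_le (n m q : ℕ) (hm : m ≤ n * q) :
    ∃ A : Fin m → Fin n, ∀ j, (univ.filter fun e => A e = j).card ≤ q := by
  refine ⟨fun e => ⟨e / q, Nat.div_lt_of_lt_mul (by have := e.2; rw [mul_comm]; omega)⟩,
    fun j => ?_⟩
  rcases Nat.eq_zero_or_pos q with rfl | hq
  · have : m = 0 := by simpa using hm
    subst this
    simp
  · refine (card_le_card_of_injOn (t := range q) (fun e : Fin m => (e : ℕ) % q)
      (fun e _ => by simpa using Nat.mod_lt _ hq) ?_).trans_eq (card_range q)
    intro a ha b hb hab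
    have ha' : (a : ℕ) / q = j := by simpa [Fin.ext_iff] using ha
    have hb' : (b : ℕ) / q = j := by simpa [Fin.ext_iff] using hb
    ext
    rw [← Nat.div_add_mod (a : ℕ) q, ← Nat.div_add_mod (b : ℕ) q, ha', hb']
    exact congrArg _ hab

/-- The MinMaxShare is at most the largest bundle disutility of any given allocation. -/
theorem MMS_le_of_allocation {n m : ℕ} [NeZero n] {v : Fin m → ℝ} {c : ℝ} (A : Fin m → Fin n)
    (hA : ∀ j, ∑ e ∈ univ.filter (fun e => A e = j), v e ≤ c) : MMS n m v ≤ c :=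
  (ciInf_le (Set.finite_range _).bddBelow A).trans (ciSup_le hA)

/-- The MinMaxShare is at least `c` when every allocation has a bundle of disutility at
least `c`. -/
theorem le_MMS_of_forall_allocation {n m : ℕ} [NeZero n] {v : Fin m → ℝ} {c : ℝ}
    (h : ∀ A : Fin m → Fin n, ∃ j, c ≤ ∑ e ∈ univ.filter (fun e => A e = j), v e) :
    c ≤ MMS n m v :=
  le_ciInf fun A => (h A).elim fun j hj => hj.trans <|
    le_ciSup (f := fun j => ∑ e ∈ univ.filter (fun e => A e = j), v e)
      (Set.finite_range _).bddAbove j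

/-- If there are at most `n * q` objects, each of disutility at most `α`, then the MinMaxShare is
at most `q * α`. -/
theorem MMS_le_mul {n m q : ℕ} [NeZero n] {v : Fin m → ℝ} {α : ℝ} (hα : 0 ≤ α)
    (hv : ∀ e, v e ≤ α) (hm : m ≤ n * q) : MMS n m v ≤ q * α := by
  obtain ⟨A, hA⟩ := exists_allocation_card_le n m q hm
  refine MMS_le_of_allocation A fun j => (sum_le_card_nsmul _ _ α fun e _ => hv e).trans ?_
  rw [nsmul_eq_mul]
  exact mul_le_mul_of_nonneg_right (by exact_mod_cast hA j) hα

/-- If more than `n * k` objects have disutility at least `α`, then the MinMaxShare is at least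
`(k + 1) * α`. -/
theorem mul_le_MMS {n m k : ℕ} [NeZero n] {v : Fin m → ℝ} {α : ℝ} (hα : 0 ≤ α)
    (hv : ∀ e, 0 ≤ v e) (s : Finset (Fin m)) (hs : ∀ e ∈ s, α ≤ v e) (hcard : n * k < s.card) :
    ((k : ℝ) + 1) * α ≤ MMS n m v := by
  refine le_MMS_of_forall_allocation fun A => ?_
  obtain ⟨j, -, hj⟩ := exists_lt_card_fiber_of_mul_lt_card_of_maps_to
    (s := s) (t := univ) (f := A) (n := k) (fun _ _ => mem_univ _) (by simpa using hcard)
  refine ⟨j, ?_⟩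
  calc ((k : ℝ) + 1) * α ≤ (s.filter fun e => A e = j).card * α :=
        mul_le_mul_of_nonneg_right (by exact_mod_cast hj) hα
    _ = (s.filter fun e => A e = j).card • α := (nsmul_eq_mul _ _).symm
    _ ≤ ∑ e ∈ s.filter (fun e => A e = j), v e :=
        card_nsmul_le_sum _ _ _ fun e he => hs e (mem_filter.1 he).1
    _ ≤ ∑ e ∈ univ.filter (fun e => A e = j), v e :=
        sum_le_sum_of_subset_of_nonneg (filter_subset_filter _ (subset_univ s))
          fun e _ _ => hv e

/-- The disutility function with `C` objects of value `α` and one object carrying the remaining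
value `1 - C * α` has maximum single-object value `α`. -/
theorem Vmem_of_remainder {m C : ℕ} {α : ℝ} {v : Fin m → ℝ} (hC : 0 < C) (hCm : C < m)
    (hα : 0 ≤ α) (hlo : C * α ≤ 1) (hhi : 1 ≤ (C + 1) * α)
    (hv : ∀ e : Fin m, v e = if (e : ℕ) < C then α else if (e : ℕ) = C then 1 - C * α else 0) :
    Vmem α m v := by
  refine ⟨⟨fun e => ?_, ?_⟩, ?_⟩
  · rw [hv]
    split_ifs <;> linarith
  · simp_rw [hv]
    rw [Fin.sum_univ_eq_sum_range
      (fun i => if i < C then α else if i = C then 1 - C * α else 0) m,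
      ← sum_subset (range_subset_range.2 (Nat.succ_le_of_lt hCm)), sum_range_succ,
      sum_congr rfl fun i hi => if_pos (mem_range.1 hi)]
    · simp
    · intro i _ hi
      rw [mem_range] at hi
      rw [if_neg (by omega), if_neg (by omega)]
  · have : Nonempty (Fin m) := ⟨⟨0, by omega⟩⟩
    refine le_antisymm (ciSup_le fun e => ?_) ?_
    · rw [hv]
      split_ifs <;> linarith
    · refine le_ciSup_of_le (Set.finite_range v).bddAbove ⟨0, by omega⟩ ?_
      rw [hv, if_pos hC]

theorem stmt6 (n k : ℕ) (hn : 2 ≤ n) (hnk : ¬(n = 2 ∧ k = 1)) (α : ℝ)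
    (hD1 : 1/((k:ℝ)*(n:ℝ)+(n:ℝ)+1) < α)
    (hD2 : α ≤ ((k:ℝ)+2)/((n:ℝ)*((k:ℝ)+1)^2 + (k:ℝ) + 2))
    (m : ℕ) (hm1 : ⌈1/α⌉ ≤ (m : ℤ)) (hm2 : m ≤ k*n + n) :
    (∀ v : Fin m → ℝ, Vmem α m v → MMS n m v ≤ ((k:ℝ)+1)*α) ∧
    (∀ v : Fin m → ℝ,
      (∀ e : Fin m, v e =
        if ((e:ℕ) : ℤ) < ⌈1/α⌉ - 1 then α
        else if ((e:ℕ) : ℤ) = ⌈1/α⌉ - 1 then 1 - ((⌈1/α⌉ : ℝ) - 1)*α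
        else 0) →
      Vmem α m v ∧ MMS n m v = ((k:ℝ)+1)*α) := by
  have : NeZero n := ⟨by omega⟩
  have hα : 0 < α := lt_of_le_of_lt (by positivity) hD1
  have hm : m ≤ n * (k + 1) := by linarith
  have upper (v : Fin m → ℝ) (hv : Vmem α m v) : MMS n m v ≤ ((k : ℝ) + 1) * α := by
    have h := MMS_le_mul (q := k + 1) hα.le
      (fun e => (le_ciSup (Set.finite_range v).bddAbove e).trans_eq hv.2) hm
    exact_mod_cast h
  refine ⟨upper, fun v hv => ?_⟩
  have hceil : (n * k + 1 : ℤ) < ⌈1 / α⌉ := by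
    rw [Int.lt_ceil, lt_div_iff₀ hα]
    rw [le_div_iff₀ (by positivity)] at hD2
    have hn0 : (0 : ℝ) < n * α := mul_pos (by exact_mod_cast (by omega : 0 < n)) hα
    push_cast
    nlinarith
  obtain ⟨C, hC⟩ : ∃ C : ℕ, ⌈1 / α⌉ = C + 1 :=
    ⟨(⌈1 / α⌉ - 1).toNat, by
      have : (0 : ℤ) ≤ n * k := by positivity
      omega⟩
  have hlo : (C : ℝ) * α ≤ 1 := by
    have h : (C : ℝ) < 1 / α := by
      have := Int.ceil_lt_add_one (1 / α)
      rw [hC] at this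
      push_cast at this
      linarith
    exact ((lt_div_iff₀ hα).1 h).le
  have hhi : 1 ≤ ((C : ℝ) + 1) * α := by
    have h := Int.le_ceil (1 / α)
    rw [hC] at h
    push_cast at h
    exact (div_le_iff₀ hα).1 h
  have hCk : n * k < C := by
    rw [hC] at hceil
    exact_mod_cast (by linarith : (n * k : ℤ) < C)
  have hCm : C < m := by omega
  have hv' (e : Fin m) :
      v e = if (e : ℕ) < C then α else if (e : ℕ) = C then 1 - C * α else 0 := by
    have h := hv e
    rw [hC] at h
    simpa using h
  have hmem := Vmem_of_remainder (by omega) hCm hα.le hlo hhi hv'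
  refine ⟨hmem, (upper v hmem).antisymm ?_⟩
  refine mul_le_MMS hα.le hmem.1.1 (univ.map (Fin.castLEEmb hCm.le)) (fun e he => ?_)
    (by simpa using hCk)
  obtain ⟨i, -, rfl⟩ := mem_map.1 he
  rw [hv', if_pos (by simp)]
end

section
/- Let n ≥ 2 and k ≥ 0 be integers, not simultaneously n = 2 and k = 1, and let 0 < α < 1. If α ∈ D(n,k), then for every integer m ≥ ⌈1/α⌉ and every v ∈ V(α;m) one has MMS_n(v) ≤ ((k+2)/(k+1))·(1−α)/n, and there exist an integer m ≥ ⌈1/α⌉ and v ∈ V(α;m) with MMS_n(v) = ((k+2)/(k+1))·(1−α)/n. If α ∈ I(n,k), then for every integer m ≥ ⌈1/α⌉ and every v ∈ V(α;m) one has MMS_n(v) ≤ (k+1)α, and there exist an integer m ≥ ⌈1/α⌉ and v ∈ V(α;m) with MMS_n(v) = (k+1)α. -/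
open Finset

section Packing

variable {ι : Type*}

/-- The objects of `s`, weighted by `w`, fit into `n` bins of capacity `C`. -/
def Packable (w : ι → ℝ) (n : ℕ) (C : ℝ) (s : Finset ι) : Prop :=
  ∃ A : ι → Fin n, ∀ j, ∑ e ∈ s.filter (fun e => A e = j), w e ≤ C

theorem packable_one {w : ι → ℝ} {C : ℝ} {s : Finset ι} (h : ∑ e ∈ s, w e ≤ C) :
    Packable w 1 C s := by
  refine ⟨fun _ => 0, fun j => ?_⟩
  rw [Finset.filter_true_of_mem (fun _ _ => Subsingleton.elim _ _)]
  exact h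

variable [DecidableEq ι]

theorem Packable.insert_of_average {w : ι → ℝ} {n : ℕ} {C : ℝ} {s : Finset ι} {x : ι}
    (hn : 0 < n) (hx : x ∉ s) (hs : Packable w n C s)
    (h : ∑ e ∈ s, w e + n * w x ≤ n * C) : Packable w n C (insert x s) := by
  obtain ⟨A, hA⟩ := hs
  have : NeZero n := ⟨hn.ne'⟩
  obtain ⟨j, -, hj⟩ : ∃ j ∈ (univ : Finset (Fin n)),
      ∑ e ∈ s.filter (fun e => A e = j), w e ≤ C - w x := by
    refine Finset.exists_le_of_sum_le ⟨0, mem_univ _⟩ ?_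
    rw [Finset.sum_fiberwise]
    simp only [sum_const, card_univ, Fintype.card_fin, nsmul_eq_mul]
    linarith
  refine ⟨Function.update A x j, fun i => ?_⟩
  have hfil : s.filter (fun e => Function.update A x j e = i) = s.filter (fun e => A e = i) :=
    Finset.filter_congr fun e he => by
      rw [Function.update_of_ne (ne_of_mem_of_not_mem he hx)]
  rw [Finset.filter_insert, hfil]
  by_cases hij : j = i
  · subst hij
    rw [if_pos (by simp), sum_insert (fun h => hx (mem_filter.1 h).1)]
    linarith
  · rw [if_neg (by simpa using hij)]
    exact hA i

theorem Packable.add_bin {w : ι → ℝ} {n : ℕ} {C : ℝ} {s t : Finset ι}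
    (hts : t ⊆ s) (ht : ∑ e ∈ t, w e ≤ C) (h : Packable w n C (s \ t)) :
    Packable w (n + 1) C s := by
  obtain ⟨A, hA⟩ := h
  refine ⟨fun e => if e ∈ t then Fin.last n else (A e).castSucc, fun j => ?_⟩
  induction j using Fin.lastCases with
  | last =>
    refine le_trans (le_of_eq (Finset.sum_congr ?_ fun _ _ => rfl)) ht
    ext e
    by_cases he : e ∈ t
    · simp [he, hts he]
    · simp [he]
  | cast j =>
    refine le_trans (le_of_eq (Finset.sum_congr ?_ fun _ _ => rfl)) (hA j)
    ext e
    by_cases he : e ∈ t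
    · simp [he, (Fin.castSucc_lt_last j).ne']
    · simp [he]

theorem packable_of_card_le {w : ι → ℝ} {K : ℕ} {C b : ℝ} (hb : 0 ≤ b) (hK : K * b ≤ C)
    (n : ℕ) (hn : 0 < n) (s : Finset ι) (hw : ∀ e ∈ s, w e ≤ b) (hs : s.card ≤ n * K) :
    Packable w n C s := by
  have hbound : ∀ t : Finset ι, (∀ e ∈ t, w e ≤ b) → t.card ≤ K → ∑ e ∈ t, w e ≤ C := by
    intro t ht htK
    have h1 := Finset.sum_le_card_nsmul t w b ht
    rw [nsmul_eq_mul] at h1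
    have h2 : (t.card : ℝ) * b ≤ K * b := by gcongr
    linarith
  induction n, hn using Nat.le_induction generalizing s with
  | base => exact packable_one (hbound s hw (by omega))
  | succ n hn ih =>
    obtain ⟨t, hts, ht⟩ := Finset.exists_subset_card_eq (min_le_right K s.card)
    refine Packable.add_bin hts (hbound t (fun e he => hw e (hts he)) (by omega))
      (ih _ (fun e he => hw e (mem_sdiff.1 he).1) ?_)
    rw [Finset.card_sdiff_of_subset hts]
    rw [Nat.succ_mul] at hs
    omega

theorem exists_subset_card_sum_le {w : ι → ℝ} {a : ℝ} {p : ℕ} (s : Finset ι)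
    (hs : ∑ e ∈ s, w e ≤ s.card * a) (hp : p ≤ s.card) :
    ∃ t ⊆ s, t.card = p ∧ ∑ e ∈ t, w e ≤ p * a := by
  induction s using Finset.strongInduction with
  | H s ih =>
    rcases hp.eq_or_lt with rfl | hlt
    · exact ⟨s, Subset.refl s, rfl, hs⟩
    obtain ⟨x, hx, hxa⟩ : ∃ x ∈ s, ∑ e ∈ s, w e ≤ s.card * w x := by
      obtain ⟨x, hx, hmax⟩ := s.exists_max_image w (card_pos.1 (by omega))
      exact ⟨x, hx, by simpa using Finset.sum_le_card_nsmul s w _ hmax⟩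
    have hcard := Finset.card_erase_add_one hx
    have hcardR : (s.card : ℝ) = (s.erase x).card + 1 := by exact_mod_cast hcard.symm
    have hsum := Finset.sum_erase_add s w hx
    obtain ⟨t, hts, ht⟩ := ih (s.erase x) (Finset.erase_ssubset hx) (by
      have h0 : (0 : ℝ) ≤ (s.erase x).card := Nat.cast_nonneg _
      rw [hcardR] at hs hxa
      rcases le_total a (w x) with h | h
      · linarith
      · nlinarith) (by omega)
    exact ⟨t, hts.trans (Finset.erase_subset _ _), ht⟩

theorem packable_capacity_two {w : ι → ℝ} {n : ℕ} (hn : 0 < n) (s : Finset ι)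
    (hw : ∀ e ∈ s, w e ≤ 2) (hs : ∑ e ∈ s, w e ≤ n + 1) (hw0 : ∀ e ∈ s, 0 ≤ w e) :
    Packable w n 2 s := by
  induction s using Finset.strongInduction with
  | H s ih =>
    by_cases h : ∃ x ∈ s, w x ≤ 1
    · obtain ⟨x, hx, hx1⟩ := h
      have hsum := Finset.sum_erase_add s w hx
      have := hw0 x hx
      rw [← Finset.insert_erase hx]
      refine Packable.insert_of_average hn (Finset.notMem_erase x s)
        (ih _ (Finset.erase_ssubset hx) (fun e he => hw e (mem_of_mem_erase he)) (by linarith)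
          (fun e he => hw0 e (mem_of_mem_erase he))) ?_
      have : (1 : ℝ) ≤ n := by exact_mod_cast hn
      nlinarith
    · push Not at h
      refine packable_of_card_le (K := 1) (b := 2) (by norm_num) (by norm_num) n hn s hw ?_
      by_contra! hcard
      have hne : s.Nonempty := card_pos.1 (by omega)
      have h1 := Finset.sum_lt_sum_of_nonempty hne h
      have h2 : ((n : ℝ) + 1) ≤ s.card := by exact_mod_cast (by omega : n + 1 ≤ s.card)
      simp at h1
      linarith

theorem packable_insert_of_three_le {w : ι → ℝ} {n K : ℕ} (hn : 3 ≤ n) (hK : 2 ≤ K) {a : ι}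
    {s : Finset ι} (ha : a ∉ s) (hmax : ∀ e ∈ s, w e ≤ w a) (haK : K * w a ≤ K + 1)
    (ha1 : 1 ≤ w a) (hs : ∑ e ∈ s, w e ≤ n * K)
    (hlarge : ∀ e ∈ s, n - w a < (n - 1) * w e) (hcard : n * K ≤ s.card) :
    Packable w n (K + 1) (insert a s) := by
  have hnR : (3 : ℝ) ≤ n := by exact_mod_cast hn
  have hKR : (2 : ℝ) ≤ K := by exact_mod_cast hK
  have hmax' : ∀ e ∈ insert a s, w e ≤ w a := by
    intro e he
    rcases mem_insert.1 he with rfl | he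
    exacts [le_rfl, hmax e he]
  have hl : ∀ e ∈ s, ((n : ℝ) - 1) * K - 1 < (n - 1) * K * w e := by
    intro e he
    nlinarith [mul_lt_mul_of_pos_left (hlarge e he) (by linarith : (0 : ℝ) < K)]
  have hl' : ∀ e ∈ s, (K : ℝ) ≤ (K + 1) * w e := by
    intro e he
    have h1 := hl e he
    by_contra! h2
    have h3 : (0 : ℝ) < (n - 1) * K := by nlinarith
    have h4 := mul_lt_mul_of_pos_left h2 h3
    have h5 : ((n : ℝ) - 1) * K ≥ K + 1 := by nlinarith
    nlinarith
  have hupper : s.card ≤ n * K + 1 := by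
    by_contra! hc
    have hc' : (n : ℝ) * K + 2 ≤ s.card := by exact_mod_cast hc
    have hne : s.Nonempty := card_pos.1 (by omega)
    have h1 := Finset.sum_lt_sum_of_nonempty hne hl
    rw [← Finset.mul_sum, sum_const, nsmul_eq_mul] at h1
    have h3 : (0 : ℝ) < (n - 1) * K - 1 := by nlinarith
    have h4 := mul_le_mul_of_nonneg_right hc' h3.le
    have h5 := mul_le_mul_of_nonneg_left hs (by nlinarith : (0 : ℝ) ≤ (n - 1) * K)
    have h6 : 0 ≤ ((n : ℝ) - 3) * (K - 2) := by
      apply mul_nonneg <;> linarith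
    nlinarith
  obtain ⟨N, rfl⟩ : ∃ N, n = N + 3 := ⟨n - 3, by omega⟩
  have hb : 0 ≤ w a := by linarith
  have hcardR : (((N + 3 : ℕ) : ℝ)) * K ≤ s.card := by exact_mod_cast hcard
  have hKcard : K + 1 ≤ s.card := by nlinarith
  obtain ⟨t, hts, htc, ht⟩ := exists_subset_card_sum_le (a := 1) s (by linarith) hKcard
  have hins : ∀ {u : Finset ι}, u ⊆ s → a ∉ u := fun h h' => ha (h h')
  have ht' : ∑ e ∈ t, w e ≤ (K : ℝ) + 1 := by push_cast at ht; linarith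
  refine Packable.add_bin (n := N + 2) (hts.trans (subset_insert _ _)) ht' ?_
  rw [Finset.insert_sdiff_of_notMem _ (hins hts)]
  have hcs := Finset.card_sdiff_of_subset hts
  have hexp : (N + 3) * K = (N + 1) * K + 2 * K := by ring
  have hexp' : (N + 2) * K = (N + 1) * K + K := by ring
  rcases (by omega : s.card = (N + 3) * K ∨ s.card = (N + 3) * K + 1) with hM | hM
  · refine packable_of_card_le hb haK _ (by omega) _
      (fun e he => hmax' e (insert_subset_insert _ sdiff_subset he)) ?_
    rw [card_insert_of_notMem (hins sdiff_subset)]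
    omega
  · have hlow : (K : ℝ) ≤ ∑ e ∈ t, w e := by
      have h1 := Finset.card_nsmul_le_sum t (fun e => (K + 1) * w e) K
        (fun e he => hl' e (hts he))
      rw [← Finset.mul_sum, htc, nsmul_eq_mul] at h1
      push_cast at h1
      exact le_of_mul_le_mul_left h1 (by linarith)
    have hsd := Finset.sum_sdiff (f := w) hts
    have hcs' : (s \ t).card = (N + 2) * K := by omega
    obtain ⟨u, hus, huc, hu⟩ := exists_subset_card_sum_le (a := 1) (p := K + 1) (s \ t) (by
      rw [hcs']
      push_cast at hs ⊢
      linarith) (by nlinarith)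
    refine Packable.add_bin (t := u) (hus.trans (subset_insert _ _))
      (by push_cast at hu; linarith) ?_
    rw [Finset.insert_sdiff_of_notMem _ (hins (hus.trans sdiff_subset))]
    refine packable_of_card_le hb haK _ (by omega) _
      (fun e he => hmax' e (insert_subset_insert _ (sdiff_subset.trans sdiff_subset) he)) ?_
    rw [card_insert_of_notMem (hins (sdiff_subset.trans sdiff_subset)),
      Finset.card_sdiff_of_subset hus]
    have := Finset.card_le_card hus
    omega



/-- A set of `2K + 1` objects of total at most `2K` whose weights differ by less than `2ε` can be
split into a part of weight at most `K + 1` and a part of weight at most `K - ε`. -/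
theorem exists_balanced_subset {w : ι → ℝ} {K : ℕ} {ε : ℝ} {s : Finset ι}
    (hε : ε ≤ 1 / 3) (hK : 1 ≤ K) (hs : ∑ e ∈ s, w e ≤ 2 * K)
    (hrange : ∀ x ∈ s, ∀ y ∈ s, w y - w x < 2 * ε) (hcard : s.card = 2 * K + 1) :
    ∃ t ⊆ s, ∑ e ∈ t, w e ≤ K + 1 ∧ ∑ e ∈ s \ t, w e ≤ K - ε := by
  have hKR : (1 : ℝ) ≤ K := by exact_mod_cast hK
  have hne : ((s.powersetCard (K + 1)).filter (fun t => ∑ e ∈ t, w e ≤ K + 1)).Nonempty := by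
    obtain ⟨t, hts, htc, ht⟩ := exists_subset_card_sum_le (w := w) (a := 1) (p := K + 1) s
      (by rw [hcard]; push_cast; linarith) (by omega)
    exact ⟨t, mem_filter.2 ⟨mem_powersetCard.2 ⟨hts, htc⟩, by push_cast at ht; linarith⟩⟩
  obtain ⟨t, ht, hbest⟩ := Finset.exists_max_image _ (fun t => ∑ e ∈ t, w e) hne
  simp only [mem_filter, mem_powersetCard] at ht hbest
  obtain ⟨⟨hts, htc⟩, htK⟩ := ht
  refine ⟨t, hts, htK, ?_⟩
  by_contra! hrest
  have hsum := Finset.sum_sdiff (f := w) hts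
  have hle : ∀ x ∈ t, ∀ y ∈ s \ t, w y ≤ w x := by
    intro x hx y hy
    by_contra! hxy
    obtain ⟨hys, hyt⟩ := mem_sdiff.1 hy
    have hyt' : y ∉ t.erase x := fun h => hyt (mem_of_mem_erase h)
    have hswap := Finset.sum_insert (f := w) hyt'
    have herase := Finset.sum_erase_add t w hx
    have hr := hrange x (hts hx) y hys
    have := hbest (insert y (t.erase x)) ⟨⟨?_, ?_⟩, by linarith⟩
    · linarith
    · exact insert_subset hys ((erase_subset _ _).trans hts)
    · rw [card_insert_of_notMem hyt', card_erase_add_one hx, htc]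
  obtain ⟨x, hx, hmin⟩ := t.exists_min_image w (card_pos.1 (by omega))
  have h1 := Finset.sum_le_card_nsmul (s \ t) w _ (hle x hx)
  have h2 := Finset.card_nsmul_le_sum t w _ hmin
  have hsc : (s \ t).card = K := by rw [card_sdiff_of_subset hts]; omega
  rw [hsc, nsmul_eq_mul] at h1
  rw [htc, nsmul_eq_mul] at h2
  push_cast at h2
  nlinarith

theorem packable_two_insert {w : ι → ℝ} {K : ℕ} (hK : 3 ≤ K) {a : ι} {s : Finset ι} (ha : a ∉ s)
    (hmax : ∀ e ∈ s, w e ≤ w a) (haK : K * w a ≤ K + 1) (ha1 : 1 ≤ w a)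
    (hs : ∑ e ∈ s, w e ≤ 2 * K) (hlarge : ∀ e ∈ s, 2 - w a < w e) (hcard : 2 * K ≤ s.card) :
    Packable w 2 (K + 1) (insert a s) := by
  have hKR : (3 : ℝ) ≤ K := by exact_mod_cast hK
  have hε : w a - 1 ≤ 1 / 3 := by nlinarith
  have hins : ∀ {u : Finset ι}, u ⊆ s → a ∉ u := fun h h' => ha (h h')
  have hlow : ∀ t ⊆ s, t.Nonempty → t.card * (2 - w a) < ∑ e ∈ t, w e := by
    intro t ht hne
    have := Finset.sum_lt_sum_of_nonempty hne fun e he => hlarge e (ht he)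
    rwa [sum_const, nsmul_eq_mul] at this
  have hsplit : ∀ t ⊆ s, ∑ e ∈ t, w e ≤ K + 1 → w a + ∑ e ∈ s \ t, w e ≤ K + 1 →
      Packable w 2 (K + 1) (insert a s) := by
    intro t hts ht hrest
    refine Packable.add_bin (n := 1) (hts.trans (subset_insert _ _)) ht (packable_one ?_)
    rw [Finset.insert_sdiff_of_notMem _ (hins hts), Finset.sum_insert (hins sdiff_subset)]
    exact hrest
  have hupper : s.card ≤ 2 * K + 2 := by
    by_contra! hc
    have hc' : 2 * (K : ℝ) + 3 ≤ s.card := by exact_mod_cast hc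
    have h1 := hlow s Subset.rfl (card_pos.1 (by omega))
    have h2 : 0 ≤ (s.card - (2 * (K : ℝ) + 3)) * (2 - w a) :=
      mul_nonneg (by linarith) (by linarith)
    nlinarith
  rcases (by omega : s.card = 2 * K ∨ s.card = 2 * K + 1 ∨ s.card = 2 * K + 2)
    with hM | hM | hM
  · obtain ⟨t, hts, htc, ht⟩ := exists_subset_card_sum_le (w := w) (a := 1) (p := K + 1) s
      (by rw [hM]; push_cast; linarith) (by omega)
    refine Packable.add_bin (n := 1) (hts.trans (subset_insert _ _))
      (by push_cast at ht; linarith) ?_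
    rw [Finset.insert_sdiff_of_notMem _ (hins hts)]
    refine packable_of_card_le (by linarith) haK 1 one_pos _ (fun e he => ?_) ?_
    · rcases mem_insert.1 he with rfl | he
      exacts [le_rfl, hmax e (sdiff_subset he)]
    · rw [card_insert_of_notMem (hins sdiff_subset), Finset.card_sdiff_of_subset hts]
      omega
  · obtain ⟨t, hts, ht, hrest⟩ := exists_balanced_subset (K := K) hε (by omega) hs
      (fun x hx y hy => by linarith [hlarge x hx, hmax y hy]) hM
    exact hsplit t hts ht (by linarith)
  · obtain ⟨t, hts, htc, ht⟩ := exists_subset_card_sum_le (w := w) (a := K / (K + 1))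
      (p := K + 2) s (by rw [hM]; push_cast; field_simp; linarith) (by omega)
    have ht' : ∑ e ∈ t, w e ≤ K + 1 := by
      refine ht.trans ?_
      push_cast
      rw [← mul_div_assoc, div_le_iff₀ (by linarith)]
      nlinarith
    have h1 := hlow t hts (card_pos.1 (by omega))
    rw [htc] at h1
    push_cast at h1
    have hsum := Finset.sum_sdiff (f := w) hts
    exact hsplit t hts ht' (by nlinarith)

theorem packable_insert_max {w : ι → ℝ} {n K : ℕ} (hn : 2 ≤ n) (hK : 1 ≤ K)
    (hnK : ¬(n = 2 ∧ K = 2)) {a : ι} (s : Finset ι) (ha : a ∉ s) (hw0 : ∀ e ∈ s, 0 ≤ w e)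
    (hmax : ∀ e ∈ s, w e ≤ w a) (haK : K * w a ≤ K + 1) (ha1 : 1 ≤ w a)
    (hs : ∑ e ∈ s, w e ≤ n * K) :
    Packable w n (K + 1) (insert a s) := by
  have hnR : (2 : ℝ) ≤ n := by exact_mod_cast hn
  induction s using Finset.strongInduction with
  | H s ih =>
    by_cases hsmall : ∃ x ∈ s, (n - 1) * w x ≤ n - w a
    · obtain ⟨x, hx, hxw⟩ := hsmall
      have hsum := Finset.sum_erase_add s w hx
      have hx0 := hw0 x hx
      have hax : a ∉ s.erase x := fun h => ha (mem_of_mem_erase h)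
      have hxa : x ∉ insert a (s.erase x) := by
        rw [mem_insert, not_or]
        exact ⟨ne_of_mem_of_not_mem hx ha, Finset.notMem_erase x s⟩
      rw [← Finset.insert_erase hx, Finset.insert_comm]
      refine Packable.insert_of_average (by omega) hxa
        (ih _ (Finset.erase_ssubset hx) hax (fun e he => hw0 e (mem_of_mem_erase he))
          (fun e he => hmax e (mem_of_mem_erase he)) (by linarith)) ?_
      rw [Finset.sum_insert hax]
      linarith
    push Not at hsmall
    by_cases hcard : s.card + 1 ≤ n * K
    · refine packable_of_card_le (by linarith) haK n (by omega) _ (fun e he => ?_) ?_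
      · rcases mem_insert.1 he with rfl | he
        exacts [le_rfl, hmax e he]
      · rwa [card_insert_of_notMem ha]
    rcases (by omega : K = 1 ∨ (n = 2 ∧ 3 ≤ K) ∨ (3 ≤ n ∧ 2 ≤ K)) with rfl | ⟨rfl, hK3⟩ | ⟨hn3, hK2⟩
    · obtain ⟨p, rfl⟩ : ∃ p, n = p + 1 := ⟨n - 1, by omega⟩
      push_cast at haK hs ⊢
      refine Packable.add_bin (t := {a}) (by simp) (by simpa using haK) ?_
      rw [Finset.insert_sdiff_of_mem _ (mem_singleton_self a),
        Finset.sdiff_singleton_eq_erase, Finset.erase_eq_of_notMem ha, show (1 : ℝ) + 1 = 2 by norm_num]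
      exact packable_capacity_two (by omega) s (fun e he => by linarith [hmax e he])
        (by linarith) hw0
    · exact packable_two_insert hK3 ha hmax haK ha1 (by exact_mod_cast hs)
        (fun e he => by have := hsmall e he; push_cast at this; linarith) (by omega)
    · exact packable_insert_of_three_le hn3 hK2 ha hmax haK ha1 hs hsmall (by omega)

end Packing

theorem MMS_le_of_packable {n m : ℕ} (hn : 0 < n) {v : Fin m → ℝ} {C : ℝ}
    (h : Packable v n C univ) : MMS n m v ≤ C := by
  obtain ⟨A, hA⟩ := h
  have : Nonempty (Fin n) := ⟨⟨0, hn⟩⟩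
  exact ciInf_le_of_le (Set.finite_range _).bddBelow A (ciSup_le hA)

theorem le_MMS_of_card_lt {n m q : ℕ} (hn : 0 < n) {v : Fin m → ℝ} {β : ℝ}
    (hβ : 0 ≤ β) (hv : ∀ e, 0 ≤ v e) (T : Finset (Fin m)) (hT : n * q < T.card)
    (hTβ : ∀ e ∈ T, β ≤ v e) : (q + 1) * β ≤ MMS n m v := by
  have : Nonempty (Fin n) := ⟨⟨0, hn⟩⟩
  refine le_ciInf fun A => ?_
  obtain ⟨j, -, hj⟩ := Finset.exists_lt_card_fiber_of_mul_lt_card_of_maps_to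
    (s := T) (t := univ) (f := A) (n := q) (fun _ _ => mem_univ _) (by simpa using hT)
  refine le_ciSup_of_le (Set.finite_range _).bddAbove j ?_
  have h1 := Finset.card_nsmul_le_sum (T.filter fun e => A e = j) v β
    (fun e he => hTβ e (mem_filter.1 he).1)
  rw [nsmul_eq_mul] at h1
  have h2 : ((q : ℝ) + 1) ≤ (T.filter fun e => A e = j).card := by exact_mod_cast hj
  calc ((q : ℝ) + 1) * β ≤ (T.filter fun e => A e = j).card * β := by gcongr
    _ ≤ ∑ e ∈ T.filter fun e => A e = j, v e := h1
    _ ≤ _ := Finset.sum_le_sum_of_subset_of_nonneg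
      (Finset.filter_subset_filter _ (subset_univ _)) fun e _ _ => hv e

theorem Vmem.exists_eq {α : ℝ} {m : ℕ} {v : Fin m → ℝ} (h : Vmem α m v) :
    ∃ a, v a = α ∧ ∀ e, v e ≤ v a := by
  obtain ⟨⟨-, hsum⟩, hsup⟩ := h
  have : Nonempty (Fin m) := by
    by_contra hne
    rw [not_nonempty_iff] at hne
    simp at hsum
  obtain ⟨a, ha⟩ := Finite.exists_max v
  exact ⟨a, hsup ▸ le_antisymm (le_ciSup (Set.finite_range v).bddAbove a) (ciSup_le ha), ha⟩

theorem Vmem.ceil_le {α : ℝ} (hα : 0 < α) {m : ℕ} {v : Fin m → ℝ} (h : Vmem α m v) :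
    ⌈1 / α⌉ ≤ (m : ℤ) := by
  obtain ⟨a, ha, hmax⟩ := h.exists_eq
  rw [Int.ceil_le, div_le_iff₀ hα]
  have := Finset.sum_le_card_nsmul univ v α (fun e _ => ha ▸ hmax e)
  rw [h.1.2] at this
  simpa using this

theorem Vmem_append {p q : ℕ} (hp : 0 < p) {α β : ℝ} (hα : 0 ≤ α) (hβ : 0 ≤ β) (hβα : β ≤ α)
    (hsum : p * α + q * β = 1) :
    Vmem α (p + q) (Fin.append (fun _ : Fin p => α) (fun _ : Fin q => β)) := by
  have hle : ∀ e, Fin.append (fun _ : Fin p => α) (fun _ : Fin q => β) e ≤ α := fun e => by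
    induction e using Fin.addCases <;> simp [hβα]
  refine ⟨⟨fun e => ?_, ?_⟩, ?_⟩
  · induction e using Fin.addCases <;> simp [hα, hβ]
  · simpa [Fin.sum_univ_add] using hsum
  · have : Nonempty (Fin (p + q)) := ⟨⟨0, by omega⟩⟩
    refine le_antisymm (ciSup_le hle)
      (le_ciSup_of_le (Set.finite_range _).bddAbove (Fin.castAdd q ⟨0, hp⟩)
        (Fin.append_left (fun _ : Fin p => α) (fun _ : Fin q => β) _).ge)

theorem MMS_le_of_scale {n K m : ℕ} (hn : 2 ≤ n) (hK : 1 ≤ K) (hnK : ¬(n = 2 ∧ K = 2))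
    {α c : ℝ} (hc : 0 < c) (hcα : c ≤ α) (hα : K * α ≤ (K + 1) * c) (hrest : 1 - α ≤ n * K * c)
    {v : Fin m → ℝ} (hv : Vmem α m v) : MMS n m v ≤ (K + 1) * c := by
  obtain ⟨a, rfl, hmax⟩ := hv.exists_eq
  have hsum := Finset.add_sum_erase univ v (mem_univ a)
  rw [hv.1.2] at hsum
  have h := packable_insert_max (w := fun e => v e / c) hn hK hnK (univ.erase a)
    (Finset.notMem_erase a _) (fun e _ => div_nonneg (hv.1.1 e) hc.le)
    (fun e _ => div_le_div_of_nonneg_right (hmax e) hc.le)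
    (by rw [← mul_div_assoc, div_le_iff₀ hc]; exact hα) (by rwa [le_div_iff₀ hc, one_mul])
    (by rw [← Finset.sum_div, div_le_iff₀ hc]; linarith)
  rw [Finset.insert_erase (mem_univ a)] at h
  obtain ⟨A, hA⟩ := h
  refine MMS_le_of_packable (by omega) ⟨A, fun j => ?_⟩
  have := hA j
  rwa [← Finset.sum_div, div_le_iff₀ hc] at this

theorem stmt12 (n k : ℕ) (hn : 2 ≤ n) (hnk : ¬(n = 2 ∧ k = 1)) (α : ℝ)
    (hα0 : 0 < α) (hα1 : α < 1) :
    ((1/((k:ℝ)*(n:ℝ)+(n:ℝ)+1) < α ∧ α ≤ ((k:ℝ)+2)/((n:ℝ)*((k:ℝ)+1)^2 + (k:ℝ) + 2)) →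
      (∀ m : ℕ, ⌈1/α⌉ ≤ (m : ℤ) → ∀ v : Fin m → ℝ, Vmem α m v →
        MMS n m v ≤ (((k:ℝ)+2)/((k:ℝ)+1)) * (1-α)/(n:ℝ)) ∧
      (∃ m : ℕ, ⌈1/α⌉ ≤ (m : ℤ) ∧ ∃ v : Fin m → ℝ, Vmem α m v ∧
        MMS n m v = (((k:ℝ)+2)/((k:ℝ)+1)) * (1-α)/(n:ℝ))) ∧
    ((((k:ℝ)+2)/((n:ℝ)*((k:ℝ)+1)^2 + (k:ℝ) + 2) < α ∧ α ≤ 1/((k:ℝ)*(n:ℝ)+1)) →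
      (∀ m : ℕ, ⌈1/α⌉ ≤ (m : ℤ) → ∀ v : Fin m → ℝ, Vmem α m v →
        MMS n m v ≤ ((k:ℝ)+1)*α) ∧
      (∃ m : ℕ, ⌈1/α⌉ ≤ (m : ℤ) ∧ ∃ v : Fin m → ℝ, Vmem α m v ∧
        MMS n m v = ((k:ℝ)+1)*α)) := by
  have hnR : (2 : ℝ) ≤ n := by exact_mod_cast hn
  have hkR : (0 : ℝ) ≤ k := Nat.cast_nonneg k
  have hden : (0 : ℝ) < n * (k + 1) ^ 2 + k + 2 := by positivity
  have hnK : ¬(n = 2 ∧ k + 1 = 2) := by omega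
  refine ⟨fun ⟨hlo, hhi⟩ => ?_, fun ⟨hlo, hhi⟩ => ?_⟩
  · rw [div_lt_iff₀ (by positivity)] at hlo
    rw [le_div_iff₀ hden] at hhi
    set c := (1 - α) / (n * (k + 1)) with hc
    have hc0 : 0 < c := div_pos (by linarith) (by positivity)
    have hval : ((k : ℝ) + 2) / (k + 1) * (1 - α) / n = ((k + 1 : ℕ) + 1) * c := by
      rw [hc]
      push_cast
      field_simp
      ring
    have hrest : n * ((k + 1 : ℕ) : ℝ) * c = 1 - α := by
      rw [hc]
      push_cast
      field_simp
    have hcα : c ≤ α := by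
      rw [hc, div_le_iff₀ (by positivity)]
      linarith
    have hup : ∀ m : ℕ, ∀ v : Fin m → ℝ, Vmem α m v → MMS n m v ≤ ((k + 1 : ℕ) + 1) * c := by
      intro m v hv
      refine MMS_le_of_scale hn (by omega) hnK hc0 hcα ?_ hrest.ge hv
      rw [hc, ← mul_div_assoc, le_div_iff₀ (by positivity)]
      push_cast
      linarith
    rw [hval]
    refine ⟨fun m _ v hv => hup m v hv, ?_⟩
    have hV := Vmem_append (p := 1) (q := n * (k + 1)) one_pos hα0.le hc0.le hcα
      (by push_cast at hrest ⊢; linarith)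
    refine ⟨_, hV.ceil_le hα0, _, hV, (hup _ _ hV).antisymm ?_⟩
    refine le_MMS_of_card_lt (by omega) hc0.le hV.1.1 univ ?_ fun e _ => ?_
    · rw [card_univ, Fintype.card_fin]
      omega
    · induction e using Fin.addCases <;> simp [hcα]
  · rw [div_lt_iff₀ hden] at hlo
    rw [le_div_iff₀ (by positivity)] at hhi
    set c := (k + 1) * α / (k + 2) with hc
    have hc0 : 0 < c := by positivity
    have hval : ((k : ℝ) + 1) * α = ((k + 1 : ℕ) + 1) * c := by
      rw [hc]
      push_cast
      field_simp
      ring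
    have hup : ∀ m : ℕ, ∀ v : Fin m → ℝ, Vmem α m v → MMS n m v ≤ (k + 1) * α := by
      intro m v hv
      rw [hval]
      refine MMS_le_of_scale hn (by omega) hnK hc0 ?_ ?_ ?_ hv
      · rw [hc, div_le_iff₀ (by positivity)]
        linarith
      · rw [← hval]
        push_cast
        rfl
      · rw [hc, ← mul_div_assoc, le_div_iff₀ (by positivity)]
        push_cast
        linarith
    refine ⟨fun m _ v hv => hup m v hv, ?_⟩
    set ρ := 1 - (k * n + 1) * α with hρ
    have hρ0 : 0 ≤ ρ := by linarith
    obtain ⟨q, hq⟩ := exists_nat_gt (ρ / α)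
    have hq0 : (0 : ℝ) < q := (div_nonneg hρ0 hα0.le).trans_lt hq
    rw [div_lt_iff₀ hα0] at hq
    have hV := Vmem_append (p := n * k + 1) (q := q) (β := ρ / q) (by omega) hα0.le
      (div_nonneg hρ0 hq0.le) (by rw [div_le_iff₀ hq0]; linarith)
      (by rw [mul_div_cancel₀ _ hq0.ne']; push_cast; linarith)
    refine ⟨_, hV.ceil_le hα0, _, hV, (hup _ _ hV).antisymm ?_⟩
    refine le_MMS_of_card_lt (by omega) hα0.le hV.1.1
      (univ.map (Fin.castAddEmb q)) (by simp) fun e he => ?_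
    obtain ⟨i, -, rfl⟩ := mem_map.1 he
    exact (Fin.append_left (fun _ : Fin (n * k + 1) => α) (fun _ : Fin q => ρ / q) i).ge
end
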